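/- arXiv:1112.6176 — 3 statements merged into one kernel-verified Lean document; each statement's English description precedes it below -/
import Mathlib

section
/- Let f : [a,b] → ℝ be a positive function with 0 ≤ a < b and f integrable on [a,b]. If f is s-convex in the second sense on [a,b] for some fixed s ∈ (0,1], then for every α > 0: 2^{s-1} · f((a+b)/2) ≤ (Γ(α+1)/(b-a)^α) · (J_{a+}^α f(b) + J_{b-}^α f(a))/2. -/
open MeasureTheory intervalIntegral Real

/-- An `s`-convex function in the second sense that is nonnegative at the endpoints is bounded
above by the sum of its endpoint values. -/
lemma sConvex_le_add_endpoints {a b s : ℝ} {f : ℝ → ℝ} (hab : a < b) (hs : 0 < s)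
    (hfa : 0 ≤ f a) (hfb : 0 ≤ f b)
    (hconv : ∀ x ∈ Set.Icc a b, ∀ y ∈ Set.Icc a b, ∀ lam ∈ Set.Icc (0:ℝ) 1,
      f (lam * x + (1 - lam) * y) ≤ lam ^ s * f x + (1 - lam) ^ s * f y)
    {t : ℝ} (ht : t ∈ Set.Icc a b) : f t ≤ f a + f b := by
  have hba : 0 < b - a := sub_pos.2 hab
  have h0 : 0 ≤ (b - t) / (b - a) := div_nonneg (sub_nonneg.2 ht.2) hba.le
  have h1 : (b - t) / (b - a) ≤ 1 := (div_le_one hba).2 (by linarith [ht.1])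
  have h := hconv a (Set.left_mem_Icc.2 hab.le) b (Set.right_mem_Icc.2 hab.le) _ ⟨h0, h1⟩
  have e : (b - t) / (b - a) * a + (1 - (b - t) / (b - a)) * b = t := by
    field_simp
    ring
  rw [e] at h
  exact h.trans (add_le_add
    (mul_le_of_le_one_left hfa (rpow_le_one h0 h1 hs.le))
    (mul_le_of_le_one_left hfb (rpow_le_one (by linarith) (by linarith) hs.le)))

/-- The midpoint inequality for `s`-convex functions, at points symmetric about the midpoint. -/
lemma sConvex_midpoint_le {a b s : ℝ} {f : ℝ → ℝ}
    (hconv : ∀ x ∈ Set.Icc a b, ∀ y ∈ Set.Icc a b, ∀ lam ∈ Set.Icc (0:ℝ) 1,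
      f (lam * x + (1 - lam) * y) ≤ lam ^ s * f x + (1 - lam) ^ s * f y)
    {t : ℝ} (ht : t ∈ Set.Icc a b) :
    2 ^ s * f ((a + b) / 2) ≤ f t + f (a + b - t) := by
  have h := hconv t ht (a + b - t) ⟨by linarith [ht.2], by linarith [ht.1]⟩ (1 / 2)
    ⟨by norm_num, by norm_num⟩
  rw [show (1 / 2 : ℝ) * t + (1 - 1 / 2) * (a + b - t) = (a + b) / 2 by ring,
    show (1 - 1 / 2 : ℝ) = 1 / 2 by norm_num, ← mul_add,
    div_rpow zero_le_one zero_le_two, one_rpow, one_div] at h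
  exact (le_inv_mul_iff₀ (rpow_pos_of_pos two_pos s)).1 h

lemma intervalIntegrable_sub_rpow {a b α : ℝ} (hα : 0 < α) :
    IntervalIntegrable (fun t => (b - t) ^ (α - 1)) volume a b := by
  have h := (intervalIntegrable_rpow' (a := b - a) (b := 0)
    (show -1 < α - 1 by linarith)).comp_sub_left b
  simpa using h

lemma integral_sub_rpow {a b α : ℝ} (hα : 0 < α) :
    ∫ t in a..b, (b - t) ^ (α - 1) = (b - a) ^ α / α := by
  rw [integral_comp_sub_left (fun x => x ^ (α - 1)) b, sub_self,
    integral_rpow (Or.inl (by linarith))]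
  simp [zero_rpow hα.ne']

/-- Hermite–Hadamard type inequality (left-hand side) for `s`-convex functions in the
second sense via Riemann–Liouville fractional integrals. -/
theorem sConvex_fractional_hadamard_left
    (a b s α : ℝ) (f : ℝ → ℝ)
    (ha : 0 ≤ a) (hab : a < b)
    (hpos : ∀ x ∈ Set.Icc a b, 0 < f x)
    (hint : IntervalIntegrable f volume a b)
    (hs0 : 0 < s) (hs1 : s ≤ 1)
    (hconv : ∀ x ∈ Set.Icc a b, ∀ y ∈ Set.Icc a b, ∀ lam ∈ Set.Icc (0:ℝ) 1,
      f (lam * x + (1 - lam) * y) ≤ lam ^ s * f x + (1 - lam) ^ s * f y)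
    (hα : 0 < α) :
    2 ^ (s - 1) * f ((a + b) / 2) ≤
      Real.Gamma (α + 1) / (b - a) ^ α *
        (((1 / Real.Gamma α) * ∫ t in a..b, (b - t) ^ (α - 1) * f t) +
          ((1 / Real.Gamma α) * ∫ t in a..b, (t - a) ^ (α - 1) * f t)) / 2 := by
  have hbdd : ∀ t ∈ Set.Icc a b, ‖f t‖ ≤ f a + f b := fun t ht => by
    rw [Real.norm_of_nonneg (hpos t ht).le]
    exact sConvex_le_add_endpoints hab hs0 (hpos a (Set.left_mem_Icc.2 hab.le)).le
      (hpos b (Set.right_mem_Icc.2 hab.le)).le hconv ht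
  have hrefl : IntervalIntegrable (fun t => f (a + b - t)) volume a b := by
    simpa using (hint.comp_sub_left (a + b)).symm
  have hw := intervalIntegrable_sub_rpow (a := a) (b := b) hα
  have mul_integrable : ∀ g : ℝ → ℝ, IntervalIntegrable g volume a b →
      (∀ t ∈ Set.Icc a b, ‖g t‖ ≤ f a + f b) →
      IntervalIntegrable (fun t => (b - t) ^ (α - 1) * g t) volume a b := by
    intro g hg hgb
    rw [intervalIntegrable_iff_integrableOn_Ioc_of_le hab.le] at hg hw ⊢
    exact hw.mul_bdd (c := f a + f b) hg.aestronglyMeasurable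
      (ae_restrict_of_forall_mem measurableSet_Ioc
        fun t ht => hgb t (Set.Ioc_subset_Icc_self ht))
  have hf := mul_integrable f hint hbdd
  have hf' := mul_integrable _ hrefl fun t ht =>
    hbdd (a + b - t) ⟨by linarith [ht.2], by linarith [ht.1]⟩
  have hswap : ∫ t in a..b, (b - t) ^ (α - 1) * f (a + b - t) =
      ∫ t in a..b, (t - a) ^ (α - 1) * f t := by
    have h := integral_comp_sub_left (a := a) (b := b)
      (fun t => (t - a) ^ (α - 1) * f t) (a + b)
    simpa [show ∀ t, a + b - t - a = b - t from fun t => by ring] using h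
  have key : (b - a) ^ α / α * (2 ^ s * f ((a + b) / 2)) ≤
      (∫ t in a..b, (b - t) ^ (α - 1) * f t) + ∫ t in a..b, (t - a) ^ (α - 1) * f t := by
    rw [← hswap, ← integral_add hf hf', ← integral_sub_rpow hα,
      ← intervalIntegral.integral_mul_const]
    refine integral_mono_on hab.le (hw.mul_const _) (hf.add hf') fun t ht => ?_
    rw [← mul_add]
    exact mul_le_mul_of_nonneg_left (sConvex_midpoint_le hconv ht)
      (rpow_nonneg (sub_nonneg.2 ht.2) _)
  have hΓ : Real.Gamma α ≠ 0 := (Real.Gamma_pos_of_pos hα).ne'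
  have hc : 0 < (b - a) ^ α := rpow_pos_of_pos (sub_pos.2 hab) α
  rw [← mul_add, Real.Gamma_add_one hα.ne', rpow_sub_one two_ne_zero]
  calc 2 ^ s / 2 * f ((a + b) / 2)
      = α / (b - a) ^ α / 2 * ((b - a) ^ α / α * (2 ^ s * f ((a + b) / 2))) := by
        field_simp
    _ ≤ α / (b - a) ^ α / 2 * _ := mul_le_mul_of_nonneg_left key (by positivity)
    _ = _ := by field_simp
end

section
/- Let f : [0,∞) → ℝ be a positive function with 0 ≤ a < b, f integrable on the relevant intervals, and suppose f is m-convex for some m ∈ (0,1]. Then f(m(a+b)/2) ≤ (1/(b−a)) ∫_a^b (f(mx) + m·f(x))/2 dx ≤ (1/2)·[ (f(ma) + m²·f(b/m))/2 + m·(f(a)+f(b))/2 ]. -/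
open MeasureTheory intervalIntegral Real

/-- Integral of the affine function interpolating `p` at `a` and `q` at `b`. -/
theorem integral_affine_interpolation {a b : ℝ} (hab : a < b) (p q : ℝ) :
    ∫ x in a..b, ((b - x) / (b - a) * p + (x - a) / (b - a) * q) = (b - a) * ((p + q) / 2) := by
  have hne : b - a ≠ 0 := (sub_pos.2 hab).ne'
  have hrw : ∀ x : ℝ, (b - x) / (b - a) * p + (x - a) / (b - a) * q =
      (b * p - a * q) / (b - a) + (q - p) / (b - a) * x := fun x => by
    field_simp
    ring
  simp_rw [hrw]
  rw [intervalIntegral.integral_add (by simp) (Continuous.intervalIntegrable (by fun_prop) _ _),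
    intervalIntegral.integral_const_mul, integral_id, intervalIntegral.integral_const,
    smul_eq_mul]
  field_simp
  ring

/-- Hermite–Hadamard type inequality for `m`-convex functions (Corollary, case `α = 1`). -/
theorem mConvex_hadamard
    (a b m : ℝ) (f : ℝ → ℝ)
    (ha : 0 ≤ a) (hab : a < b)
    (hpos : ∀ x, 0 ≤ x → 0 < f x)
    (hint1 : IntervalIntegrable f volume (m * a) (m * b))
    (hint2 : IntervalIntegrable f volume a b)
    (hm0 : 0 < m) (hm1 : m ≤ 1)
    (hconv : ∀ x, 0 ≤ x → ∀ y, 0 ≤ y → ∀ t ∈ Set.Icc (0:ℝ) 1,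
      f (t * x + m * (1 - t) * y) ≤ t * f x + m * (1 - t) * f y) :
    (f (m * (a + b) / 2) ≤ (1 / (b - a)) * ∫ x in a..b, (f (m * x) + m * f x) / 2) ∧
      (1 / (b - a)) * (∫ x in a..b, (f (m * x) + m * f x) / 2) ≤
        1 / 2 * ((f (m * a) + m ^ 2 * f (b / m)) / 2 + m * (f a + f b) / 2) := by
  have hd : 0 < b - a := sub_pos.2 hab
  have hfm : IntervalIntegrable (fun x => f (m * x)) volume a b := by
    have h := hint1.comp_mul_left (c := m)
    rwa [mul_div_cancel_left₀ _ hm0.ne', mul_div_cancel_left₀ _ hm0.ne'] at h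
  have hF : IntervalIntegrable (fun x => (f (m * x) + m * f x) / 2) volume a b :=
    (hfm.add (hint2.const_mul m)).div_const 2
  have hrefl : IntervalIntegrable (fun x => f (a + b - x)) volume a b := by
    have h := (hint2.comp_sub_left (a + b)).symm
    rwa [add_sub_cancel_right, add_sub_cancel_left] at h
  rw [one_div_mul_eq_div]
  constructor
  · rw [le_div_iff₀ hd]
    calc
      f (m * (a + b) / 2) * (b - a) = ∫ _ in a..b, f (m * (a + b) / 2) := by
        rw [intervalIntegral.integral_const, smul_eq_mul, mul_comm]
      _ ≤ ∫ x in a..b, (f (m * x) + m * f (a + b - x)) / 2 := by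
        refine intervalIntegral.integral_mono_on hab.le (by simp)
          ((hfm.add (hrefl.const_mul m)).div_const 2) fun x hx => ?_
        have h := hconv (m * x) (mul_nonneg hm0.le (ha.trans hx.1)) (a + b - x)
          (by linarith [hx.2]) (1 / 2) (by norm_num)
        rw [show 1 / 2 * (m * x) + m * (1 - 1 / 2) * (a + b - x) = m * (a + b) / 2 by ring] at h
        linarith
      _ = ∫ x in a..b, (f (m * x) + m * f x) / 2 := by
        have h : ∫ x in a..b, f (a + b - x) = ∫ x in a..b, f x := by
          rw [intervalIntegral.integral_comp_sub_left f, add_sub_cancel_right,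
            add_sub_cancel_left]
        rw [intervalIntegral.integral_div, intervalIntegral.integral_div,
          intervalIntegral.integral_add hfm (hrefl.const_mul m),
          intervalIntegral.integral_add hfm (hint2.const_mul m),
          intervalIntegral.integral_const_mul, intervalIntegral.integral_const_mul, h]
  · rw [div_le_iff₀ hd]
    calc
      ∫ x in a..b, (f (m * x) + m * f x) / 2
          ≤ ∫ x in a..b, ((b - x) / (b - a) * ((f (m * a) + m * f a) / 2) +
              (x - a) / (b - a) * ((m * f b + m ^ 2 * f (b / m)) / 2)) := by
        refine intervalIntegral.integral_mono_on hab.le hF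
          (Continuous.intervalIntegrable (by fun_prop) _ _) fun x hx => ?_
        have ht : (b - x) / (b - a) ∈ Set.Icc (0 : ℝ) 1 :=
          ⟨div_nonneg (by linarith [hx.2]) hd.le, (div_le_one hd).2 (by linarith [hx.1])⟩
        have hb : 0 ≤ b := ha.trans hab.le
        have ht' : 1 - (b - x) / (b - a) = (x - a) / (b - a) := by
          field_simp
          ring
        have h₁ := hconv (m * a) (mul_nonneg hm0.le ha) b hb _ ht
        have h₂ := hconv a ha (b / m) (div_nonneg hb hm0.le) _ ht
        rw [ht'] at h₁ h₂
        rw [show (b - x) / (b - a) * (m * a) + m * ((x - a) / (b - a)) * b = m * x by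
          field_simp
          ring] at h₁
        rw [show (b - x) / (b - a) * a + m * ((x - a) / (b - a)) * (b / m) = x by
          field_simp
          ring] at h₂
        linarith [mul_le_mul_of_nonneg_left h₂ hm0.le]
      _ = _ := by
        rw [integral_affine_interpolation hab]
        ring
end

section
/- Let f : [0,∞) → [0,∞) be s-convex in the second sense for some fixed s ∈ (0,1), let 0 ≤ a < b and suppose f is integrable on [a,b]. Then 2^{s−1}·f((a+b)/2) ≤ (1/(b−a)) ∫_a^b f(x) dx ≤ (f(a)+f(b))/(s+1). -/
open MeasureTheory intervalIntegral Real

lemma integral_div_rpow_eq {c s : ℝ} (hc : 0 < c) (hs : 0 < s) :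
    ∫ x in (0 : ℝ)..c, (x / c) ^ s = c / (s + 1) := by
  rw [intervalIntegral.integral_comp_div (fun x : ℝ => x ^ s) hc.ne', zero_div, div_self hc.ne',
    integral_rpow (Or.inl (by linarith)), one_rpow, zero_rpow (by linarith), smul_eq_mul]
  ring

/-- Hermite–Hadamard inequality of Dragomir and Fitzpatrick for `s`-convex functions in
the second sense. -/
theorem sConvex_hadamard
    (a b s : ℝ) (f : ℝ → ℝ)
    (hf_nonneg : ∀ x, 0 ≤ x → 0 ≤ f x)
    (hs0 : 0 < s) (hs1 : s < 1)
    (hconv : ∀ x, 0 ≤ x → ∀ y, 0 ≤ y → ∀ lam ∈ Set.Icc (0:ℝ) 1,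
      f (lam * x + (1 - lam) * y) ≤ lam ^ s * f x + (1 - lam) ^ s * f y)
    (ha : 0 ≤ a) (hab : a < b)
    (hint : IntervalIntegrable f volume a b) :
    (2 ^ (s - 1) * f ((a + b) / 2) ≤ (1 / (b - a)) * ∫ x in a..b, f x) ∧
      (1 / (b - a)) * (∫ x in a..b, f x) ≤ (f a + f b) / (s + 1) := by
  have hba : 0 < b - a := sub_pos.2 hab
  constructor
  · have hrefl : IntervalIntegrable (fun x => f (a + b - x)) volume a b := by
      simpa using (hint.comp_sub_left (a + b)).symm
    have hrefl_eq : ∫ x in a..b, f (a + b - x) = ∫ x in a..b, f x := by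
      simp
    have hmid : ∀ x ∈ Set.Icc a b,
        f ((a + b) / 2) ≤ (1 / 2 : ℝ) ^ s * (f x + f (a + b - x)) := by
      intro x hx
      have h := hconv x (ha.trans hx.1) (a + b - x) (by linarith [hx.2]) (1 / 2) (by norm_num)
      rw [show (1 / 2 : ℝ) * x + (1 - 1 / 2) * (a + b - x) = (a + b) / 2 by ring,
        show (1 - 1 / 2 : ℝ) = 1 / 2 by norm_num] at h
      linarith
    have h := intervalIntegral.integral_mono_on hab.le (intervalIntegrable_const (μ := volume))
      ((hint.add hrefl).const_mul ((1 / 2 : ℝ) ^ s)) hmid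
    rw [intervalIntegral.integral_const, intervalIntegral.integral_const_mul,
      intervalIntegral.integral_add hint hrefl, hrefl_eq, smul_eq_mul] at h
    have hpow : (2 : ℝ) ^ s * (1 / 2 : ℝ) ^ s = 1 := by
      rw [← mul_rpow (by norm_num) (by norm_num)]
      norm_num
    rw [rpow_sub_one two_ne_zero, one_div_mul_eq_div, le_div_iff₀ hba]
    calc (2 : ℝ) ^ s / 2 * f ((a + b) / 2) * (b - a)
        = (2 : ℝ) ^ s / 2 * ((b - a) * f ((a + b) / 2)) := by ring
      _ ≤ (2 : ℝ) ^ s / 2 *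
          ((1 / 2 : ℝ) ^ s * ((∫ x in a..b, f x) + ∫ x in a..b, f x)) := by gcongr
      _ = ((2 : ℝ) ^ s * (1 / 2 : ℝ) ^ s) * ∫ x in a..b, f x := by ring
      _ = ∫ x in a..b, f x := by rw [hpow, one_mul]
  · have hleft : IntervalIntegrable (fun x => ((b - x) / (b - a)) ^ s * f a) volume a b :=
      ((((continuous_const.sub continuous_id).div_const _).rpow_const
        fun _ => Or.inr hs0.le).mul continuous_const).intervalIntegrable a b
    have hright : IntervalIntegrable (fun x => ((x - a) / (b - a)) ^ s * f b) volume a b :=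
      ((((continuous_id.sub continuous_const).div_const _).rpow_const
        fun _ => Or.inr hs0.le).mul continuous_const).intervalIntegrable a b
    have hchord : ∀ x ∈ Set.Icc a b,
        f x ≤ ((b - x) / (b - a)) ^ s * f a + ((x - a) / (b - a)) ^ s * f b := by
      intro x hx
      have h := hconv a ha b (ha.trans hab.le) ((b - x) / (b - a))
        ⟨div_nonneg (by linarith [hx.2]) hba.le, (div_le_one hba).2 (by linarith [hx.1])⟩
      have hcompl : 1 - (b - x) / (b - a) = (x - a) / (b - a) := by
        field_simp
        ring
      have hcomb : (b - x) / (b - a) * a + (x - a) / (b - a) * b = x := by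
        field_simp
        ring
      rwa [hcompl, hcomb] at h
    have h := intervalIntegral.integral_mono_on hab.le hint (hleft.add hright) hchord
    rw [intervalIntegral.integral_add hleft hright, intervalIntegral.integral_mul_const,
      intervalIntegral.integral_mul_const,
      intervalIntegral.integral_comp_sub_left (fun x => (x / (b - a)) ^ s),
      intervalIntegral.integral_comp_sub_right (fun x => (x / (b - a)) ^ s),
      sub_self, sub_self, integral_div_rpow_eq hba hs0] at h
    rw [one_div_mul_eq_div, div_le_iff₀ hba]
    calc (∫ x in a..b, f x)
        ≤ (b - a) / (s + 1) * f a + (b - a) / (s + 1) * f b := h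
      _ = (f a + f b) / (s + 1) * (b - a) := by ring
end
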